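/- Over an algebraically closed field of characteristic p > 0, any reduced irreducible flexy plane curve of degree d > 1 satisfies d ≥ p. -/

import Mathlib

open MvPolynomial

section Derivations

variable {σ R A : Type*} [CommRing R] [CommRing A] [Algebra R A]

/-- The restriction of a polynomial to the parametrized line `v + X w`. -/
noncomputable def restrictLine (v w : σ → A) : MvPolynomial σ R →ₐ[R] Polynomial A :=
  aeval fun i => Polynomial.C (v i) + Polynomial.X * Polynomial.C (w i)

/-- The derivation of `A[X]` acting by `D` on coefficients and killing `X`. -/
noncomputable def coeffDerivation (D : Derivation R A A) :
    Derivation R (Polynomial A) (Polynomial A) :=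
  PolynomialModule.equivPolynomialSelf.toLinearMap.compDer D.mapCoeffs

lemma coeff_coeffDerivation (D : Derivation R A A) (P : Polynomial A) (n : ℕ) :
    (coeffDerivation D P).coeff n = D (P.coeff n) := rfl

lemma coeffDerivation_X (D : Derivation R A A) :
    coeffDerivation D Polynomial.X = 0 := by
  simp [coeffDerivation]

lemma coeffDerivation_C (D : Derivation R A A) (a : A) :
    coeffDerivation D (Polynomial.C a) = Polynomial.C (D a) := by
  ext n
  rw [coeff_coeffDerivation, Polynomial.coeff_C, Polynomial.coeff_C]
  split_ifs <;> simp

lemma derivation_aeval [Fintype σ] (D : Derivation R A A) (f : σ → A) (G : MvPolynomial σ R) :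
    D (aeval f G) = ∑ i, aeval f (pderiv i G) * D (f i) := by
  classical
  induction G using MvPolynomial.induction_on with
  | C a => simp
  | add P Q hP hQ => simp [hP, hQ, add_mul, Finset.sum_add_distrib]
  | mul_X P j hP =>
    simp only [map_mul, aeval_X, Derivation.leibniz, hP, smul_eq_mul, map_add, pderiv_X,
      add_mul, Finset.sum_add_distrib, Finset.mul_sum]
    congr 1
    · rw [Finset.sum_eq_single j] <;> simp +contextual [eq_comm]
    · exact Finset.sum_congr rfl fun i _ => by ring

lemma pderiv_comm (i j : σ) (G : MvPolynomial σ R) :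
    pderiv i (pderiv j G) = pderiv j (pderiv i G) := by
  classical
  induction G using MvPolynomial.induction_on with
  | C a => simp
  | add P Q hP hQ => simp [hP, hQ]
  | mul_X P l hP =>
    simp only [Derivation.leibniz, smul_eq_mul, map_add, pderiv_X, Pi.single_apply, hP]
    split_ifs <;> simp [add_comm, add_left_comm]

lemma derivative_restrictLine [Fintype σ] (v w : σ → A) (G : MvPolynomial σ R) :
    Polynomial.derivative (restrictLine v w G) =
      ∑ i, restrictLine v w (pderiv i G) * Polynomial.C (w i) := by
  have := derivation_aeval (R := R) (Polynomial.derivative'.restrictScalars R)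
    (fun i => Polynomial.C (v i) + Polynomial.X * Polynomial.C (w i)) G
  simpa [restrictLine] using this

lemma eval_zero_restrictLine (v w : σ → A) (G : MvPolynomial σ R) :
    (restrictLine v w G).eval 0 = aeval v G := by
  rw [← Polynomial.coe_aeval_eq_eval, restrictLine]
  have := DFunLike.congr_fun (comp_aeval (R := R)
    (fun i => Polynomial.C (v i) + Polynomial.X * Polynomial.C (w i))
    ((Polynomial.aeval (R := A) (0 : A)).restrictScalars R)) G
  simpa using this

lemma eval_one_restrictLine (v w : σ → A) (G : MvPolynomial σ R) :
    (restrictLine v w G).eval 1 = aeval (v + w) G := by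
  rw [← Polynomial.coe_aeval_eq_eval, restrictLine]
  have := DFunLike.congr_fun (comp_aeval (R := R)
    (fun i => Polynomial.C (v i) + Polynomial.X * Polynomial.C (w i))
    ((Polynomial.aeval (R := A) (1 : A)).restrictScalars R)) G
  simpa [Pi.add_def] using this

lemma map_eval_restrictLine (v : σ → R) (w : σ → MvPolynomial σ R) (G : MvPolynomial σ R) :
    (restrictLine X w G).map (eval v) = restrictLine v (fun i => eval v (w i)) G := by
  have := DFunLike.congr_fun (comp_aeval (R := R)
    (fun i => Polynomial.C (X i) + Polynomial.X * Polynomial.C (w i))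
    (Polynomial.mapAlgHom (aeval (R := R) v))) G
  simpa [restrictLine, aeval_eq_eval] using this

/-- Along a vector field `w` which at `v` is an eigenvector of its own derivative, the
coefficients of the restriction to the line `v + X w` satisfy a recursion. -/
lemma eval_mkDerivation_coeff_restrictLine [Fintype σ] (w : σ → MvPolynomial σ R) (v : σ → R)
    (c : R) (hw : ∀ i, eval v (mkDerivation R w (w i)) = c * eval v (w i))
    (G : MvPolynomial σ R) (m : ℕ) :
    eval v (mkDerivation R w ((restrictLine X w G).coeff m)) =
      (m + 1) * (restrictLine v (fun i => eval v (w i)) G).coeff (m + 1) +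
        c * m * (restrictLine v (fun i => eval v (w i)) G).coeff m := by
  have h : (coeffDerivation (mkDerivation R w) (restrictLine X w G)).map (eval v) =
      (1 + Polynomial.C c * Polynomial.X) *
        Polynomial.derivative (restrictLine v (fun i => eval v (w i)) G) := by
    have h1 := derivation_aeval (coeffDerivation (mkDerivation R w))
      (fun i => Polynomial.C (X i) + Polynomial.X * Polynomial.C (w i)) G
    rw [restrictLine, h1, derivative_restrictLine, Polynomial.map_sum, Finset.mul_sum]
    refine Finset.sum_congr rfl fun i _ => ?_
    rw [Polynomial.map_mul, ← map_eval_restrictLine v w, restrictLine]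
    simp [coeffDerivation_X, coeffDerivation_C, hw]
    ring
  rw [← coeff_coeffDerivation, ← Polynomial.coeff_map, h, add_mul, one_mul, Polynomial.coeff_add,
    Polynomial.coeff_derivative, mul_assoc, Polynomial.coeff_C_mul]
  cases m with
  | zero => simp
  | succ m =>
    rw [Polynomial.coeff_X_mul, Polynomial.coeff_derivative]
    push_cast
    ring

end Derivations

section LinearAlgebra

open Matrix

lemma exists_dotProduct_eq_one {ι k : Type*} [Field k] [Fintype ι] [DecidableEq ι] {g : ι → k}
    (hg : g ≠ 0) : ∃ h : ι → k, h ⬝ᵥ g = 1 := by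
  obtain ⟨i, hi⟩ := Function.ne_iff.mp hg
  exact ⟨Pi.single i (g i)⁻¹, by simpa using inv_mul_cancel₀ hi⟩

lemma exists_mulVec_eq_smul {ι k : Type*} [Field k] [Fintype ι] [DecidableEq ι]
    (h2 : (2 : k) ≠ 0) (M : Matrix ι ι k) (hM : M.IsSymm) {g : ι → k} (hg : g ≠ 0)
    (hiso : ∀ w, w ⬝ᵥ g = 0 → w ⬝ᵥ M *ᵥ w = 0) {s : ι → k} (hs : s ⬝ᵥ g = 0) :
    ∃ c : k, M *ᵥ s = c • g := by
  obtain ⟨h, hh⟩ := exists_dotProduct_eq_one hg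
  have polar : ∀ x, x ⬝ᵥ g = 0 → x ⬝ᵥ M *ᵥ s = 0 := by
    intro x hx
    have h3 := hiso (x + s) (by simp [add_dotProduct, hx, hs])
    have h4 : s ⬝ᵥ M *ᵥ x = x ⬝ᵥ M *ᵥ s := by
      rw [dotProduct_mulVec, ← mulVec_transpose, hM.eq, dotProduct_comm]
    rw [mulVec_add, add_dotProduct, dotProduct_add, dotProduct_add, hiso x hx, hiso s hs, h4] at h3
    have : 2 * (x ⬝ᵥ M *ᵥ s) = 0 := by linear_combination h3
    exact (mul_eq_zero.mp this).resolve_left h2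
  refine ⟨h ⬝ᵥ M *ᵥ s, funext fun i => ?_⟩
  have h5 := polar (Pi.single i 1 - g i • h) (by simp [sub_dotProduct, hh])
  rw [sub_dotProduct, smul_dotProduct, single_one_dotProduct, sub_eq_zero] at h5
  rw [h5]
  simp [mul_comm]

end LinearAlgebra

lemma dvd_pow_of_forall_eval_eq_zero {σ k : Type*} [Finite σ] [Field k] [IsAlgClosed k]
    {P Q : MvPolynomial σ k} (h : ∀ v, eval v P = 0 → eval v Q = 0) : ∃ n, P ∣ Q ^ n := by
  have hQ : Q ∈ vanishingIdeal k (zeroLocus k (Ideal.span {P})) := by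
    intro v hv
    simpa [aeval_eq_eval] using h v (by
      simpa [aeval_eq_eval] using hv P (Ideal.subset_span rfl))
  rw [vanishingIdeal_zeroLocus_eq_radical] at hQ
  obtain ⟨n, hn⟩ := hQ
  exact ⟨n, Ideal.mem_span_singleton.mp hn⟩

lemma Irreducible.dvd_of_forall_eval_eq_zero {σ k : Type*} [Finite σ] [Field k] [IsAlgClosed k]
    {P Q : MvPolynomial σ k} (hP : Irreducible P) (h : ∀ v, eval v P = 0 → eval v Q = 0) :
    P ∣ Q :=
  let ⟨_, hn⟩ := dvd_pow_of_forall_eval_eq_zero h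
  hP.prime.dvd_of_dvd_pow hn

/-- An irreducible polynomial vanishing on a linear hyperplane has degree at most one. -/
lemma Irreducible.totalDegree_le_one_of_hyperplane {σ k : Type*} [Fintype σ] [Field k]
    [IsAlgClosed k] {F : MvPolynomial σ k} (hF : Irreducible F) {g : σ → k} (hg : g ≠ 0)
    (h : ∀ x : σ → k, x ⬝ᵥ g = 0 → eval x F = 0) : F.totalDegree ≤ 1 := by
  classical
  set L : MvPolynomial σ k := ∑ i, C (g i) * X i with hL
  have evalL : ∀ x, eval x L = x ⬝ᵥ g := fun x => by simp [hL, dotProduct, mul_comm]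
  obtain ⟨y, hy⟩ := exists_dotProduct_eq_one hg
  have hL0 : L ≠ 0 := fun h0 => by simpa [h0, hy] using evalL y
  have hLdeg : L.totalDegree ≤ 1 :=
    (IsHomogeneous.sum _ _ 1 fun i _ => isHomogeneous_C_mul_X (g i) i).totalDegree_le
  obtain ⟨n, hn⟩ := dvd_pow_of_forall_eval_eq_zero (P := L) (Q := F)
    fun x hx => h x (by rwa [evalL] at hx)
  obtain ⟨i, -, hi⟩ := (dvd_prime_pow hF.prime n).mp hn
  cases i with
  | zero =>
    rw [pow_zero, associated_one_iff_isUnit] at hi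
    have := (hi.map (eval (0 : σ → k))).ne_zero
    rw [evalL] at this
    simp at this
  | succ i =>
    obtain ⟨q, hq⟩ := (dvd_pow_self F i.succ_ne_zero).trans hi.symm.dvd
    rw [hq] at hLdeg hL0
    rw [totalDegree_mul_of_isDomain (left_ne_zero_of_mul hL0) (right_ne_zero_of_mul hL0)] at hLdeg
    omega

/-- An irreducible curve of degree greater than one and prime to the characteristic has a
smooth point. -/
lemma exists_smooth_point {σ k : Type*} [Fintype σ] [Field k] [IsAlgClosed k]
    {F : MvPolynomial σ k} {d : ℕ} (hd : F.IsHomogeneous d) (hF : Irreducible F)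
    (hd0 : (d : k) ≠ 0) : ∃ v, eval v F = 0 ∧ ∃ i, eval v (pderiv i F) ≠ 0 := by
  by_contra! hcon
  have hpos : d ≠ 0 := fun h => hd0 (by simp [h])
  have hz : ∀ i, pderiv i F = 0 := by
    intro i
    by_contra hne
    obtain ⟨q, hq⟩ := hF.dvd_of_forall_eval_eq_zero fun v hv => hcon v hv i
    have hdeg := hd.pderiv (i := i) |>.totalDegree hne
    rw [hq] at hne hdeg
    rw [totalDegree_mul_of_isDomain hF.ne_zero (right_ne_zero_of_mul hne),
      hd.totalDegree hF.ne_zero] at hdeg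
    omega
  have := hd.sum_X_mul_pderiv
  simp only [hz, mul_zero, Finset.sum_const_zero, nsmul_eq_mul] at this
  rw [eq_comm, mul_eq_zero, ← map_natCast (C : k →+* MvPolynomial σ k), C_eq_zero] at this
  exact this.elim hd0 hF.ne_zero

/-- The Hessian matrix of `F` at `v`. -/
noncomputable def hessian {σ k : Type*} [Field k] (F : MvPolynomial σ k) (v : σ → k) :
    Matrix σ σ k :=
  Matrix.of fun i j => eval v (pderiv j (pderiv i F))

lemma hessian_isSymm {σ k : Type*} [Field k] (F : MvPolynomial σ k) (v : σ → k) :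
    (hessian F v).IsSymm :=
  Matrix.IsSymm.ext fun i j => by simp only [hessian, Matrix.of_apply, pderiv_comm i j]

section TangentField

variable {σ k : Type*} [Fintype σ] [Field k]

/-- The polynomial vector field `(h · ∇F) u - (u · ∇F) h`, tangent to the level sets of `F`. -/
noncomputable def tangentField (F : MvPolynomial σ k) (u h : σ → k) (l : σ) : MvPolynomial σ k :=
  C (u l) * ∑ j, C (h j) * pderiv j F - C (h l) * ∑ j, C (u j) * pderiv j F

lemma mkDerivation_eq_sum (w : σ → MvPolynomial σ k) (G : MvPolynomial σ k) :
    mkDerivation k w G = ∑ i, pderiv i G * w i := by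
  simpa using derivation_aeval (mkDerivation k w) X G

lemma eval_tangentField (F : MvPolynomial σ k) (u h v : σ → k) (l : σ) :
    eval v (tangentField F u h l) =
      u l * (h ⬝ᵥ fun j => eval v (pderiv j F)) - h l * (u ⬝ᵥ fun j => eval v (pderiv j F)) := by
  simp [tangentField, dotProduct]

lemma eval_tangentField_dotProduct (F : MvPolynomial σ k) (u h v : σ → k) :
    (fun l => eval v (tangentField F u h l)) ⬝ᵥ (fun j => eval v (pderiv j F)) = 0 := by
  set g : σ → k := fun j => eval v (pderiv j F)
  have : (fun l => eval v (tangentField F u h l)) = (h ⬝ᵥ g) • u - (u ⬝ᵥ g) • h := by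
    ext l
    rw [eval_tangentField]
    simp [g, mul_comm]
  rw [this, sub_dotProduct, smul_dotProduct, smul_dotProduct, smul_eq_mul, smul_eq_mul]
  ring

lemma eval_mkDerivation_tangentField (F : MvPolynomial σ k) (u h v : σ → k) {c : k}
    (hc : Matrix.mulVec (hessian F v) (fun l => eval v (tangentField F u h l)) =
      c • fun j => eval v (pderiv j F)) (l : σ) :
    eval v (mkDerivation k (tangentField F u h) (tangentField F u h l)) =
      c * eval v (tangentField F u h l) := by
  have key : ∀ j, eval v (mkDerivation k (tangentField F u h) (pderiv j F)) =
      c * eval v (pderiv j F) := by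
    intro j
    simpa [mkDerivation_eq_sum, Matrix.mulVec, dotProduct, hessian] using congrFun hc j
  have hC : ∀ a : k, mkDerivation k (tangentField F u h) (C a) = 0 := derivation_C _
  conv_lhs => rw [tangentField]
  simp only [map_sub, Derivation.leibniz, hC, smul_eq_mul, mul_zero, add_zero, map_mul, map_sum,
    eval_C, key, eval_tangentField, dotProduct]
  simp only [mul_sub, Finset.mul_sum]
  congr 1 <;> exact Finset.sum_congr rfl fun _ _ => by ring

lemma derivative_derivative_restrictLine_eval_zero (F : MvPolynomial σ k) (v w : σ → k) :
    (Polynomial.derivative (Polynomial.derivative (restrictLine v w F))).eval 0 =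
      w ⬝ᵥ Matrix.mulVec (hessian F v) w := by
  simp only [derivative_restrictLine, Polynomial.derivative_sum, Polynomial.derivative_mul,
    Polynomial.derivative_C, mul_zero, add_zero, Polynomial.eval_finsetSum, Polynomial.eval_mul,
    Polynomial.eval_C, eval_zero_restrictLine, aeval_eq_eval, Matrix.mulVec, dotProduct,
    hessian, Matrix.of_apply]
  exact Finset.sum_congr rfl fun _ _ => mul_comm _ _

end TangentField

/-- If `F` is irreducible and the Hessian is isotropic on the tangent space at every smooth point,
then `F` vanishes identically on all tangent lines, provided its degree is less than `p`. -/
lemma restrictLine_tangentField_eq_zero {σ k : Type*} [Fintype σ] [Field k] [IsAlgClosed k]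
    (p : ℕ) [CharP k p] {F : MvPolynomial σ k} {d : ℕ} (hd : F.totalDegree ≤ d) (hdp : d < p)
    (hF : Irreducible F) (h2 : (2 : k) ≠ 0)
    (hiso : ∀ v w : σ → k, eval v F = 0 → (fun i => eval v (pderiv i F)) ≠ 0 →
      (w ⬝ᵥ fun i => eval v (pderiv i F)) = 0 → w ⬝ᵥ Matrix.mulVec (hessian F v) w = 0)
    (u h v : σ → k) (hv : eval v F = 0) :
    restrictLine v (fun l => eval v (tangentField F u h l)) F = 0 := by
  classical
  have hc : ∀ v, eval v F = 0 → ∃ c : k,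
      Matrix.mulVec (hessian F v) (fun l => eval v (tangentField F u h l)) =
        c • fun j => eval v (pderiv j F) := by
    intro v hv
    by_cases hg : (fun i => eval v (pderiv i F)) = 0
    · refine ⟨0, ?_⟩
      have : (fun l => eval v (tangentField F u h l)) = 0 := by
        ext l
        simp [eval_tangentField, hg]
      rw [this, Matrix.mulVec_zero, zero_smul]
    · exact exists_mulVec_eq_smul h2 _ (hessian_isSymm F v) hg (fun w hw => hiso v w hv hg hw)
        (eval_tangentField_dotProduct F u h v)
  have coeff_eq : ∀ v m, eval v ((restrictLine X (tangentField F u h) F).coeff m) =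
      (restrictLine v (fun l => eval v (tangentField F u h l)) F).coeff m := fun v m => by
    rw [← map_eval_restrictLine, Polynomial.coeff_map]
  have main : ∀ m ≤ d, ∀ v, eval v F = 0 →
      eval v ((restrictLine X (tangentField F u h) F).coeff m) = 0 := by
    intro m
    induction m with
    | zero =>
      intro _ v hv
      rw [coeff_eq, Polynomial.coeff_zero_eq_eval_zero, eval_zero_restrictLine, aeval_eq_eval]
      exact hv
    | succ m ih =>
      intro hm v hv
      have ih := ih (by omega)
      obtain ⟨q, hq⟩ := hF.dvd_of_forall_eval_eq_zero ih
      obtain ⟨c, hc⟩ := hc v hv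
      have hrec := eval_mkDerivation_coeff_restrictLine (tangentField F u h) v c
        (eval_mkDerivation_tangentField F u h v hc) F m
      have hDF : eval v (mkDerivation k (tangentField F u h) F) = 0 := by
        have := eval_tangentField_dotProduct F u h v
        simpa [mkDerivation_eq_sum, dotProduct, mul_comm] using this
      rw [← coeff_eq v m, ih v hv, hq, Derivation.leibniz] at hrec
      simp only [smul_eq_mul, map_add, map_mul, hv, hDF, zero_mul, mul_zero, add_zero] at hrec
      have hm0 : ((m + 1 : ℕ) : k) ≠ 0 := fun h0 => by
        have := Nat.le_of_dvd m.succ_pos ((CharP.cast_eq_zero_iff k p _).mp h0)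
        omega
      rw [coeff_eq]
      push_cast at hm0
      exact (mul_eq_zero.mp hrec.symm).resolve_left hm0
  ext m
  rw [Polynomial.coeff_zero]
  by_cases hm : m ≤ d
  · rw [← coeff_eq, main m hm v hv]
  · refine Polynomial.coeff_eq_zero_of_natDegree_lt (lt_of_le_of_lt ?_ (not_le.mp hm))
    rw [← mul_one d]
    refine aeval_natDegree_le F hd _ fun i => ?_
    compute_degree


/-- Over an algebraically closed field of characteristic `p > 0`, a reduced
irreducible flexy plane curve of degree `d > 1` satisfies `d ≥ p`. Flexy: at every
smooth point the tangent line meets the curve with intersection multiplicity at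
least 3. -/
theorem flexy_degree_ge_char (k : Type*) [Field k] [IsAlgClosed k]
    (p : ℕ) [CharP k p] (hp : p ≠ 0)
    (F : MvPolynomial (Fin 3) k) (d : ℕ) (hd : F.IsHomogeneous d)
    (hirr : Irreducible F) (hd1 : 1 < d)
    (hflexy : ∀ v w : Fin 3 → k,
      eval v F = 0 →
      (∃ i, eval v (pderiv i F) ≠ 0) →
      w ≠ 0 →
      (∑ i, w i * eval v (pderiv i F)) = 0 →
      (aeval (fun i => Polynomial.C (v i) + Polynomial.X * Polynomial.C (w i)) F = 0) ∨
        3 ≤ Polynomial.rootMultiplicity 0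
          (aeval (fun i => Polynomial.C (v i) + Polynomial.X * Polynomial.C (w i)) F)) :
    p ≤ d := by
  by_contra! hlt
  have cast_ne : ∀ n : ℕ, 0 < n → n < p → (n : k) ≠ 0 := fun n hn hnp h0 =>
    absurd (Nat.le_of_dvd hn ((CharP.cast_eq_zero_iff k p n).mp h0)) (not_le.mpr hnp)
  have h2 : (2 : k) ≠ 0 := by exact_mod_cast cast_ne 2 two_pos (by omega)
  have hiso : ∀ v w : Fin 3 → k, eval v F = 0 → (fun i => eval v (pderiv i F)) ≠ 0 →
      (w ⬝ᵥ fun i => eval v (pderiv i F)) = 0 → w ⬝ᵥ Matrix.mulVec (hessian F v) w = 0 := by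
    intro v w hv hg hw
    rcases eq_or_ne w 0 with rfl | hw0
    · simp
    rw [← derivative_derivative_restrictLine_eval_zero]
    rcases hflexy v w hv (Function.ne_iff.mp hg) hw0 hw with h0 | h3
    · simp [show restrictLine v w F = 0 from h0]
    · have hdvd : Polynomial.X ^ 3 ∣ restrictLine v w F := by
        have := (pow_dvd_pow (Polynomial.X - Polynomial.C 0) h3).trans
          (Polynomial.pow_rootMultiplicity_dvd _ 0)
        simpa [restrictLine] using this
      have hcoeff := Polynomial.X_pow_dvd_iff.mp hdvd 2 (by omega)
      simp [← Polynomial.coeff_zero_eq_eval_zero, Polynomial.coeff_derivative, hcoeff]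
  obtain ⟨v, hv, hsm⟩ := exists_smooth_point hd hirr (cast_ne d (by omega) hlt)
  set g : Fin 3 → k := fun i => eval v (pderiv i F) with hg
  have hg0 : g ≠ 0 := Function.ne_iff.mpr hsm
  obtain ⟨h, hh⟩ := exists_dotProduct_eq_one hg0
  have hvg : v ⬝ᵥ g = 0 := by
    have := congrArg (eval v) hd.sum_X_mul_pderiv
    simpa [hv, dotProduct, hg] using this
  have hdeg := hirr.totalDegree_le_one_of_hyperplane hg0 fun x hx => by
    have hw : (fun l => eval v (tangentField F (x - v) h l)) = x - v := by
      ext l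
      rw [eval_tangentField, ← hg, hh, sub_dotProduct, hx, hvg]
      simp
    have hline := restrictLine_tangentField_eq_zero p hd.totalDegree_le hlt hirr h2 hiso
      (x - v) h v hv
    rw [hw] at hline
    simpa [hline, aeval_eq_eval] using (eval_one_restrictLine v (x - v) F).symm
  rw [hd.totalDegree hirr.ne_zero] at hdeg
  omega
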